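/- Let K be a compact metric space, g : K → K a continuous map, φ : K → ℝ a continuous function, and λ < λ' real numbers. Let S be a set of g-invariant Borel probability measures on K, each ν ∈ S satisfying ∫ φ dν ≤ λ, and suppose that every g-invariant Borel probability measure on K lies in the closure, in the topology of weak convergence, of the convex hull of S. Then there exists N ∈ ℕ such that for all n ≥ N and all x ∈ K, (1/n) · ∑_{i=0}^{n-1} φ(g^i(x)) < λ'. -/

import Mathlib

open MeasureTheory Filter
open scoped ENNReal NNReal

noncomputable def empMeas {K : Type*} [MeasurableSpace K] (g : K → K) (n : ℕ) (x : K) : Measure K :=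
  ((n + 1 : ℕ) : ℝ≥0∞)⁻¹ • ∑ i ∈ Finset.range (n + 1), Measure.dirac (g^[i] x)

lemma empMeas_prob {K : Type*} [MeasurableSpace K] (g : K → K) (n : ℕ) (x : K) :
    IsProbabilityMeasure (empMeas g n x) := by
  constructor
  simp only [empMeas, Measure.smul_apply, Measure.finsetSum_apply, measure_univ, Finset.sum_const,
    Finset.card_range, smul_eq_mul, nsmul_eq_mul, mul_one]
  exact ENNReal.inv_mul_cancel (by simp) (ENNReal.natCast_ne_top _)

lemma empMeas_integral {K : Type*} [MetricSpace K] [CompactSpace K] [MeasurableSpace K]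
    [BorelSpace K] (g : K → K) (n : ℕ) (x : K) (f : K → ℝ) (hf : Continuous f) :
    ∫ y, f y ∂(empMeas g n x) =
      (1 / ((n + 1 : ℕ) : ℝ)) * ∑ i ∈ Finset.range (n + 1), f (g^[i] x) := by
  rw [empMeas, integral_smul_measure, integral_finsetSum_measure]
  · simp only [integral_dirac, ENNReal.toReal_inv, ENNReal.toReal_natCast, smul_eq_mul, one_div]
  · intro i _
    exact hf.integrable_of_hasCompactSupport (HasCompactSupport.of_compactSpace f)

theorem birkhoff_average_lt_of_closure_convexHull
    {K : Type*} [MetricSpace K] [CompactSpace K] [MeasurableSpace K] [BorelSpace K]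
    (g : K → K) (hg : Continuous g) (φ : K → ℝ) (hφ : Continuous φ)
    (lam lam' : ℝ) (hlt : lam < lam')
    (S : Set (ProbabilityMeasure K))
    (hSinv : ∀ ν ∈ S, (ν : Measure K).map g = (ν : Measure K))
    (hSle : ∀ ν ∈ S, (∫ x, φ x ∂(ν : Measure K)) ≤ lam)
    (hdense : ∀ μ : ProbabilityMeasure K, (μ : Measure K).map g = (μ : Measure K) →
      μ ∈ closure {m : ProbabilityMeasure K |
        ∃ (r : ℕ) (w : Fin r → ℝ≥0) (ν : Fin r → ProbabilityMeasure K),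
          (∑ i, w i) = 1 ∧ (∀ i, ν i ∈ S) ∧
          (m : Measure K) = ∑ i, (w i : ℝ≥0∞) • (ν i : Measure K)}) :
    ∃ N : ℕ, ∀ n ≥ N, ∀ x : K,
      (1 / (n : ℝ)) * ∑ i ∈ Finset.range n, φ (g^[i] x) < lam' := by
  by_contra hcon
  push Not at hcon
  have hint : ∀ (μ : Measure K) [IsFiniteMeasure μ] (f : K → ℝ), Continuous f → Integrable f μ :=
    fun μ _ f hf => hf.integrable_of_hasCompactSupport (HasCompactSupport.of_compactSpace f)
  have h1 : ∀ N : ℕ, ∃ n ≥ N, ∃ x : K,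
      lam' ≤ (1 / ((n + 1 : ℕ) : ℝ)) * ∑ i ∈ Finset.range (n + 1), φ (g^[i] x) := by
    intro N
    obtain ⟨n, hn, x, hx⟩ := hcon (N + 1)
    obtain ⟨m, rfl⟩ : ∃ m, n = m + 1 := ⟨n - 1, by omega⟩
    exact ⟨m, by omega, x, hx⟩
  choose n hn x hx using h1
  let P : ℕ → ProbabilityMeasure K := fun N => ⟨empMeas g (n N) (x N), empMeas_prob _ _ _⟩
  obtain ⟨μ, hμ⟩ : ∃ μ, Tendsto P (hyperfilter ℕ : Filter ℕ) (nhds μ) := by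
    haveI : Nonempty (ProbabilityMeasure K) := ⟨P 0⟩
    exact ⟨_, ((hyperfilter ℕ).map P).le_nhds_lim⟩
  have hcont : ∀ f : K → ℝ, Continuous f →
      Continuous (fun m : ProbabilityMeasure K => ∫ y, f y ∂(m : Measure K)) := by
    intro f hf
    rw [continuous_iff_continuousAt]
    intro m
    exact (ProbabilityMeasure.tendsto_iff_forall_integral_tendsto.1 tendsto_id)
      (BoundedContinuousFunction.mkOfCompact ⟨f, hf⟩)
  have hlim : ∀ f : K → ℝ, Continuous f → Tendsto
      (fun N => (1 / ((n N + 1 : ℕ) : ℝ)) * ∑ i ∈ Finset.range (n N + 1), f (g^[i] (x N)))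
      (hyperfilter ℕ : Filter ℕ) (nhds (∫ y, f y ∂(μ : Measure K))) := by
    intro f hf
    have := ((hcont f hf).tendsto μ).comp hμ
    refine this.congr fun N => ?_
    exact empMeas_integral g (n N) (x N) f hf
  have hat : ((hyperfilter ℕ : Ultrafilter ℕ) : Filter ℕ) ≤ atTop := by
    rw [← Nat.cofinite_eq_atTop]; exact hyperfilter_le_cofinite
  have hinv : (μ : Measure K).map g = (μ : Measure K) := by
    haveI : IsProbabilityMeasure ((μ : Measure K).map g) :=
      Measure.isProbabilityMeasure_map hg.aemeasurable
    apply ext_of_forall_integral_eq_of_IsFiniteMeasure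
    intro f
    rw [integral_map hg.aemeasurable f.continuous.aestronglyMeasurable]
    have hd := (hlim _ (f.continuous.comp hg)).sub (hlim _ f.continuous)
    have h0 : Tendsto (fun N : ℕ => (1 / ((N : ℝ) + 1)) * (2 * ‖f‖)) atTop (nhds 0) := by
      simpa using tendsto_one_div_add_atTop_nhds_zero_nat.mul_const (2 * ‖f‖)
    refine sub_eq_zero.1 (tendsto_nhds_unique hd (squeeze_zero_norm (fun N => ?_) (h0.mono_left hat)))
    · rw [← mul_sub, ← Finset.sum_sub_distrib]
      have : ∀ i, (f ∘ g) (g^[i] (x N)) - f (g^[i] (x N)) =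
          (fun j => f (g^[j] (x N))) (i + 1) - (fun j => f (g^[j] (x N))) i := by
        intro i
        simp only [Function.iterate_succ_apply', Function.comp]
      rw [Finset.sum_congr rfl (fun i _ => this i), Finset.sum_range_sub (fun j => f (g^[j] (x N))), norm_mul]
      have hb : ‖f (g^[n N + 1] (x N)) - f (g^[0] (x N))‖ ≤ 2 * ‖f‖ := by
        have a := f.norm_coe_le_norm (g^[n N + 1] (x N))
        have b := f.norm_coe_le_norm (g^[0] (x N))
        have c := norm_sub_le (f (g^[n N + 1] (x N))) (f (g^[0] (x N)))
        linarith
      refine mul_le_mul ?_ hb (norm_nonneg _) (by positivity)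
      rw [Real.norm_of_nonneg (by positivity)]
      apply one_div_le_one_div_of_le (by positivity)
      have : (N : ℝ) ≤ n N := by exact_mod_cast hn N
      push_cast
      linarith
  have hge : lam' ≤ ∫ y, φ y ∂(μ : Measure K) := ge_of_tendsto' (hlim φ hφ) hx
  have hle : ∫ y, φ y ∂(μ : Measure K) ≤ lam := by
    have hcl : IsClosed {m : ProbabilityMeasure K | ∫ y, φ y ∂(m : Measure K) ≤ lam} :=
      isClosed_le (hcont φ hφ) continuous_const
    refine closure_minimal ?_ hcl (hdense μ hinv)
    rintro m ⟨r, w, ν, hw, hν, hm⟩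
    simp only [Set.mem_ofPred_eq]
    rw [hm, integral_finsetSum_measure]
    · calc ∑ i, ∫ y, φ y ∂((w i : ℝ≥0∞) • (ν i : Measure K))
          = ∑ i, (w i : ℝ) * ∫ y, φ y ∂(ν i : Measure K) := by
            simp [NNReal.smul_def]
        _ ≤ ∑ i, (w i : ℝ) * lam := Finset.sum_le_sum fun i _ =>
            mul_le_mul_of_nonneg_left (hSle _ (hν i)) (w i).2
        _ = lam := by
            rw [← Finset.sum_mul, ← NNReal.coe_sum, hw]; simp
    · intro i _
      exact (hint _ φ hφ).smul_measure ENNReal.coe_ne_top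
  linarith
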